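/- arXiv:1207.1954 — 2 statements merged into one kernel-verified Lean document; each statement's English description precedes it below -/
import Mathlib

section
/- Let V ∈ M_{2g}(ℚ) be a Seifert matrix and let W ∈ M_{2g+2}(ℚ) be a row or column enlargement of V. Then there is an isomorphism of ℚ[t,t^{-1}]-modules from (ℚ[t,t^{-1}])^{2g+2}/⟨columns of tW − Wᵗ⟩ to (ℚ[t,t^{-1}])^{2g}/⟨columns of tV − Vᵗ⟩ sending, for 1 ≤ i ≤ 2g, the class of the (i+2)-nd standard basis vector to the class of the i-th standard basis vector. -/
open Matrix

/-- The standard symplectic `2g × 2g` matrix with `g` diagonal blocks `[[0,-1],[1,0]]`. -/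
def Jmat (R : Type*) [CommRing R] (g : ℕ) : Matrix (Fin (2*g)) (Fin (2*g)) R :=
  Matrix.of fun i j =>
    if i.val % 2 = 0 ∧ j.val = i.val + 1 then (-1 : R)
    else if j.val % 2 = 0 ∧ i.val = j.val + 1 then 1
    else 0

/-- A Seifert matrix: `V - Vᵀ = J`. -/
def IsSeifert {R : Type*} [CommRing R] {g : ℕ} (V : Matrix (Fin (2*g)) (Fin (2*g)) R) : Prop :=
  V - Vᵀ = Jmat R g

/-- A symplectic matrix: `P * J * Pᵀ = J`. -/
def IsSymplectic {R : Type*} [CommRing R] {g : ℕ} (P : Matrix (Fin (2*g)) (Fin (2*g)) R) : Prop :=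
  P * Jmat R g * Pᵀ = Jmat R g

/-- A rational matrix with integer entries. -/
def IsIntegralMat {n : ℕ} (P : Matrix (Fin n) (Fin n) ℚ) : Prop :=
  ∀ i j, ∃ m : ℤ, P i j = (m : ℚ)

/-- Row enlargement `[[0,0,0],[1,x,ρᵗ],[0,ρ,V]]` of a matrix `V`. -/
def rowEnl {R : Type*} [CommRing R] {g : ℕ} (V : Matrix (Fin (2*g)) (Fin (2*g)) R)
    (x : R) (ρ : Fin (2*g) → R) : Matrix (Fin (2*(g+1))) (Fin (2*(g+1))) R :=
  Matrix.of fun i j =>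
    if hi : 2 ≤ i.val then
      if hj : 2 ≤ j.val then V ⟨i.val - 2, by have := i.2; omega⟩ ⟨j.val - 2, by have := j.2; omega⟩
      else if j.val = 1 then ρ ⟨i.val - 2, by have := i.2; omega⟩ else 0
    else
      if i.val = 0 then 0
      else
        if hj : 2 ≤ j.val then ρ ⟨j.val - 2, by have := j.2; omega⟩
        else if j.val = 0 then 1 else x

/-- Column enlargement `[[0,-1,0],[0,x,ρᵗ],[0,ρ,V]]` of a matrix `V`. -/
def colEnl {R : Type*} [CommRing R] {g : ℕ} (V : Matrix (Fin (2*g)) (Fin (2*g)) R)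
    (x : R) (ρ : Fin (2*g) → R) : Matrix (Fin (2*(g+1))) (Fin (2*(g+1))) R :=
  Matrix.of fun i j =>
    if hi : 2 ≤ i.val then
      if hj : 2 ≤ j.val then V ⟨i.val - 2, by have := i.2; omega⟩ ⟨j.val - 2, by have := j.2; omega⟩
      else if j.val = 1 then ρ ⟨i.val - 2, by have := i.2; omega⟩ else 0
    else
      if i.val = 0 then (if j.val = 1 then -1 else 0)
      else
        if hj : 2 ≤ j.val then ρ ⟨j.val - 2, by have := j.2; omega⟩
        else if j.val = 0 then 0 else x

/-- `W` is an enlargement (row or column) of `V`. -/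
def IsEnlargement {R : Type*} [CommRing R] {g : ℕ} (V : Matrix (Fin (2*g)) (Fin (2*g)) R)
    (W : Matrix (Fin (2*(g+1))) (Fin (2*(g+1))) R) : Prop :=
  ∃ (x : R) (ρ : Fin (2*g) → R), W = rowEnl V x ρ ∨ W = colEnl V x ρ

/-- The diagonal matrix `diag(n, n⁻¹, 1, …, 1)` of size `2g`. -/
def Delta (g : ℕ) (n : ℚ) : Matrix (Fin (2*g)) (Fin (2*g)) ℚ :=
  Matrix.diagonal (fun i => if i.val = 0 then n else if i.val = 1 then n⁻¹ else 1)

open LaurentPolynomial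

/-- The matrix `tV - Vᵀ` over the Laurent polynomial ring. -/
noncomputable def seifPres {g : ℕ} (V : Matrix (Fin g) (Fin g) ℚ) :
    Matrix (Fin g) (Fin g) (LaurentPolynomial ℚ) :=
  Matrix.of fun i j => T 1 * C (V i j) - C (V j i)

/-- The `ℚ[t,t⁻¹]`-submodule of `(ℚ[t,t⁻¹])^g` generated by the columns of `tV - Vᵀ`. -/
noncomputable def seifCols {g : ℕ} (V : Matrix (Fin g) (Fin g) ℚ) :
    Submodule (LaurentPolynomial ℚ) (Fin g → LaurentPolynomial ℚ) :=
  Submodule.span _ {c | ∃ j, c = fun i => seifPres V i j}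

/-- A block matrix `[[0, a, 0], [b, *, *], [0, *, M]]` with `a` and `b` units presents the same
module as `M`, the generators of `M` corresponding to the last generators of the block matrix. -/
theorem exists_quotient_span_col_equiv {R : Type*} [CommRing R] {n : ℕ}
    (M : Matrix (Fin n) (Fin n) R) (N : Matrix (Fin (n + 2)) (Fin (n + 2)) R)
    (h00 : N 0 0 = 0) (h01 : IsUnit (N 0 1)) (h02 : ∀ j : Fin n, N 0 j.succ.succ = 0)
    (h10 : IsUnit (N 1 0)) (h20 : ∀ i : Fin n, N i.succ.succ 0 = 0)
    (h22 : ∀ i j : Fin n, N i.succ.succ j.succ.succ = M i j) :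
    ∃ e : ((Fin (n + 2) → R) ⧸ Submodule.span R {c | ∃ j, c = fun i => N i j}) ≃ₗ[R]
        ((Fin n → R) ⧸ Submodule.span R {c | ∃ j, c = fun i => M i j}),
      ∀ i : Fin n, e (Submodule.Quotient.mk (Pi.single i.succ.succ 1)) =
        Submodule.Quotient.mk (Pi.single i 1) := by
  obtain ⟨a, ha⟩ := h01.exists_left_inv
  obtain ⟨b, hb⟩ := h10.exists_left_inv
  set P := Submodule.span R {c | ∃ j, c = fun i => N i j} with hP
  set Q := Submodule.span R {c | ∃ j, c = fun i => M i j} with hQ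
  have hcol : ∀ j, (fun i => N i j) ∈ P := fun j => Submodule.subset_span ⟨j, rfl⟩
  let φ : (Fin (n + 2) → R) →ₗ[R] (Fin n → R) :=
    { toFun := fun f i => f i.succ.succ - a * f 0 * N i.succ.succ 1
      map_add' := fun f f' => by ext i; simp only [Pi.add_apply]; ring
      map_smul' := fun r f => by
        ext i; simp only [Pi.smul_apply, smul_eq_mul, RingHom.id_apply]; ring }
  let ψ : (Fin n → R) →ₗ[R] (Fin (n + 2) → R) :=
    { toFun := fun f => Fin.cons 0 (Fin.cons 0 f)
      map_add' := fun f f' => by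
        ext i; refine Fin.cases ?_ (fun i => Fin.cases ?_ (fun i => ?_) i) i <;> simp
      map_smul' := fun r f => by
        ext i; refine Fin.cases ?_ (fun i => Fin.cases ?_ (fun i => ?_) i) i <;> simp }
  have hφ : P ≤ Q.comap φ := by
    rw [hP, Submodule.span_le]
    rintro _ ⟨j, rfl⟩
    change φ _ ∈ Q
    refine Fin.cases ?_ (fun j => Fin.cases ?_ (fun j => ?_) j) j
    · convert Q.zero_mem using 1
      ext i
      simp [φ, h00, h20]
    · convert Q.zero_mem using 1
      ext i
      simp [φ, ha]
    · refine Submodule.subset_span ⟨j, ?_⟩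
      ext i
      simp [φ, h02, h22]
  have hψ : Q ≤ P.comap ψ := by
    rw [hQ, Submodule.span_le]
    rintro _ ⟨j, rfl⟩
    change ψ _ ∈ P
    convert P.sub_mem (hcol j.succ.succ) (P.smul_mem (N 1 j.succ.succ * b) (hcol 0)) using 1
    ext i
    refine Fin.cases ?_ (fun i => Fin.cases ?_ (fun i => ?_) i) i
    · simp [ψ, h00, h02]
    · simp [ψ, mul_assoc, hb]
    · simp [ψ, h20, h22]
  have hφψ : ∀ f, φ (ψ f) = f := fun f => by ext i; simp [φ, ψ]
  have hψφ : ∀ f, ψ (φ f) - f ∈ P := fun f => by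
    rw [← neg_sub, P.neg_mem_iff]
    convert P.add_mem (P.smul_mem (a * f 0) (hcol 1))
      (P.smul_mem ((f 1 - a * f 0 * N 1 1) * b) (hcol 0)) using 1
    ext i
    refine Fin.cases ?_ (fun i => Fin.cases ?_ (fun i => ?_) i) i
    · simp only [φ, ψ, LinearMap.coe_mk, AddHom.coe_mk, Pi.sub_apply, Pi.add_apply,
        Pi.smul_apply, smul_eq_mul, Fin.cons_zero, h00]
      linear_combination (-f 0) * ha
    · simp only [φ, ψ, LinearMap.coe_mk, AddHom.coe_mk, Pi.sub_apply, Pi.add_apply,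
        Pi.smul_apply, smul_eq_mul, Fin.cons_zero, Fin.cons_succ]
      rw [Fin.succ_zero_eq_one]
      linear_combination (-(f 1 - a * f 0 * N 1 1)) * hb
    · simp [φ, ψ, h20]
  refine ⟨LinearEquiv.ofLinearMap (P.mapQ Q φ hφ) (Q.mapQ P ψ hψ) ?_ ?_, fun i => ?_⟩
  · apply Submodule.linearMap_qext
    refine LinearMap.ext fun f => ?_
    simp [hφψ]
  · apply Submodule.linearMap_qext
    refine LinearMap.ext fun f => ?_
    simpa using (Submodule.Quotient.eq P).2 (hψφ f)
  · rw [LinearEquiv.coe_ofLinearMap, Submodule.mapQ_apply]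
    congr 1
    ext k
    simp [φ, Pi.single_apply, Fin.ext_iff]

/-- Lemma `lemmacons2`, enlargement case: an enlargement `W` of a
Seifert matrix `V` presents a `ℚ[t,t⁻¹]`-module isomorphic to the one presented by `V`,
the isomorphism sending the class of the `(i+2)`-nd generator to the class of the `i`-th
generator. -/
theorem enlargement_presentation_iso {g : ℕ}
    (V : Matrix (Fin (2*g)) (Fin (2*g)) ℚ) (hV : IsSeifert V)
    (W : Matrix (Fin (2*(g+1))) (Fin (2*(g+1))) ℚ) (hW : IsEnlargement V W) :
    ∃ e : ((Fin (2*(g+1)) → LaurentPolynomial ℚ) ⧸ seifCols W) ≃ₗ[LaurentPolynomial ℚ]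
        ((Fin (2*g) → LaurentPolynomial ℚ) ⧸ seifCols V),
      ∀ i : Fin (2*g),
        e (Submodule.Quotient.mk
            (Pi.single (⟨i.val + 2, by have := i.2; omega⟩ : Fin (2*(g+1))) 1)) =
          Submodule.Quotient.mk (Pi.single i 1) := by
  have h1 : 1 % (2 * (g + 1)) = 1 := Nat.mod_eq_of_lt (by omega)
  obtain ⟨x, ρ, rfl | rfl⟩ := hW
  · refine exists_quotient_span_col_equiv (seifPres V) (seifPres (rowEnl V x ρ) :) ?_ ?_ ?_ ?_ ?_ ?_
      <;> simp [seifPres, rowEnl, isUnit_T, h1]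
  · refine exists_quotient_span_col_equiv (seifPres V) (seifPres (colEnl V x ρ) :) ?_ ?_ ?_ ?_ ?_ ?_
      <;> simp [seifPres, colEnl, isUnit_T, h1]
end

section
/- Let V, V' ∈ M_{2g}(ℚ) be Seifert matrices and let P ∈ M_{2g}(ℚ) be a symplectic matrix with V' = P V Pᵗ. Then the ℚ[t,t^{-1}]-linear map (ℚ[t,t^{-1}])^{2g} → (ℚ[t,t^{-1}])^{2g} sending the i-th standard basis vector e_i to Σ_j P_{ji} e_j maps ⟨columns of tV − Vᵗ⟩ onto ⟨columns of tV' − V'ᵗ⟩ and induces an isomorphism of ℚ[t,t^{-1}]-modules (ℚ[t,t^{-1}])^{2g}/⟨columns of tV − Vᵗ⟩ → (ℚ[t,t^{-1}])^{2g}/⟨columns of tV' − V'ᵗ⟩. -/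
open Matrix

open LaurentPolynomial

/-- The standard symplectic matrix squares to `-1`. -/
lemma Jmat_mul_self (R : Type*) [CommRing R] (g : ℕ) : Jmat R g * Jmat R g = -1 := by
  ext i j
  obtain ⟨k, hk⟩ : ∃ k : Fin (2 * g),
      (i.val % 2 = 0 ∧ k.val = i.val + 1) ∨ (k.val % 2 = 0 ∧ i.val = k.val + 1) := by
    have := i.2
    rcases Nat.mod_two_eq_zero_or_one i.val with h | h
    · exact ⟨⟨i.val + 1, by omega⟩, Or.inl ⟨h, rfl⟩⟩
    · exact ⟨⟨i.val - 1, by omega⟩, Or.inr ⟨by simp only; omega, by simp only; omega⟩⟩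
  rw [Matrix.mul_apply, Finset.sum_eq_single k]
  · simp only [Jmat, Matrix.of_apply, Matrix.neg_apply, Matrix.one_apply, Fin.ext_iff]
    split_ifs <;> first | omega | simp
  · intro l _ hl
    rw [Ne, Fin.ext_iff] at hl
    have h0 : Jmat R g i l = 0 := by
      simp only [Jmat, Matrix.of_apply]
      split_ifs <;> first | omega | rfl
    rw [h0, zero_mul]
  · simp

lemma isUnit_Jmat (R : Type*) [CommRing R] (g : ℕ) : IsUnit (Jmat R g) :=
  .of_mul_eq_one (-Jmat R g) (by rw [mul_neg, Jmat_mul_self, neg_neg])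

lemma IsSymplectic.isUnit {R : Type*} [CommRing R] {g : ℕ}
    {P : Matrix (Fin (2 * g)) (Fin (2 * g)) R} (hP : IsSymplectic P) : IsUnit P := by
  rw [Matrix.isUnit_iff_isUnit_det]
  have hJ := (Matrix.isUnit_iff_isUnit_det _).1 (isUnit_Jmat R g)
  rw [← hP, Matrix.det_mul, Matrix.det_mul] at hJ
  exact isUnit_of_mul_isUnit_left (isUnit_of_mul_isUnit_left hJ)

lemma seifPres_eq {n : ℕ} (V : Matrix (Fin n) (Fin n) ℚ) :
    seifPres V = (T 1 : LaurentPolynomial ℚ) • V.map (algebraMap ℚ (LaurentPolynomial ℚ)) -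
      (V.map (algebraMap ℚ (LaurentPolynomial ℚ)))ᵀ := by
  ext1 i j
  simp [seifPres]

lemma seifPres_congruence {n : ℕ} (V P : Matrix (Fin n) (Fin n) ℚ) :
    seifPres (P * V * Pᵀ) = P.map (algebraMap ℚ (LaurentPolynomial ℚ)) * seifPres V *
      (P.map (algebraMap ℚ (LaurentPolynomial ℚ)))ᵀ := by
  simp only [seifPres_eq, Matrix.map_mul, Matrix.transpose_mul, Matrix.transpose_map,
    Matrix.transpose_transpose, Matrix.mul_sub, Matrix.sub_mul, Matrix.mul_smul,
    Matrix.smul_mul, Matrix.mul_assoc]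

lemma seifCols_eq_range {n : ℕ} (V : Matrix (Fin n) (Fin n) ℚ) :
    seifCols V = LinearMap.range (seifPres V).mulVecLin := by
  rw [Matrix.range_mulVecLin, seifCols]
  congr 1
  ext c
  exact exists_congr fun j => eq_comm

/-- An invertible congruence carries the column module of `tV - Vᵀ` onto that of
`t(PVPᵀ) - (PVPᵀ)ᵀ`. -/
lemma map_seifCols {n : ℕ} (V : Matrix (Fin n) (Fin n) ℚ) {P : Matrix (Fin n) (Fin n) ℚ}
    (hP : IsUnit (P.map (algebraMap ℚ (LaurentPolynomial ℚ)))) :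
    (seifCols V).map (P.map (algebraMap ℚ (LaurentPolynomial ℚ))).mulVecLin =
      seifCols (P * V * Pᵀ) := by
  have hsurj : LinearMap.range
      (P.map (algebraMap ℚ (LaurentPolynomial ℚ)))ᵀ.mulVecLin = ⊤ :=
    LinearMap.range_eq_top.2
      (Matrix.mulVec_surjective_iff_isUnit.2 ((Matrix.isUnit_transpose _).2 hP))
  rw [seifCols_eq_range, seifCols_eq_range, seifPres_congruence, Matrix.mulVecLin_mul,
    LinearMap.range_comp_of_range_eq_top _ hsurj, Matrix.mulVecLin_mul, LinearMap.range_comp]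


/-- Lemma `lemmacons2`, congruence case: a symplectic congruence
`V' = P V Pᵀ` between Seifert matrices induces, via `e_i ↦ Σ_j P_{ji} e_j`, an
isomorphism between the `ℚ[t,t⁻¹]`-modules presented by `tV - Vᵀ` and `tV' - V'ᵀ`. -/
theorem congruence_presentation_iso {g : ℕ}
    (V V' P : Matrix (Fin (2*g)) (Fin (2*g)) ℚ)
    (hV : IsSeifert V) (hV' : IsSeifert V')
    (hP : IsSymplectic P) (hcong : V' = P * V * Pᵀ) :
    Submodule.map (Matrix.mulVecLin (P.map (algebraMap ℚ (LaurentPolynomial ℚ))))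
        (seifCols V) = seifCols V' ∧
    ∃ e : ((Fin (2*g) → LaurentPolynomial ℚ) ⧸ seifCols V) ≃ₗ[LaurentPolynomial ℚ]
        ((Fin (2*g) → LaurentPolynomial ℚ) ⧸ seifCols V'),
      ∀ v : Fin (2*g) → LaurentPolynomial ℚ,
        e (Submodule.Quotient.mk v) =
          Submodule.Quotient.mk
            (Matrix.mulVecLin (P.map (algebraMap ℚ (LaurentPolynomial ℚ))) v) := by
  have hPL : IsUnit (P.map (algebraMap ℚ (LaurentPolynomial ℚ))) :=
    hP.isUnit.map (algebraMap ℚ (LaurentPolynomial ℚ)).mapMatrix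
  have hmap := map_seifCols V hPL
  rw [← hcong] at hmap
  exact ⟨hmap, Submodule.Quotient.equiv _ _
    (LinearEquiv.ofBijective (P.map (algebraMap ℚ (LaurentPolynomial ℚ))).mulVecLin
      ⟨Matrix.mulVec_injective_of_isUnit hPL, Matrix.mulVec_surjective_iff_isUnit.2 hPL⟩)
    hmap, fun _ => rfl⟩
end
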